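/- Fix a sequence (S_i)_{i≥1} of shufflers over Σ and a constant m₀ ∈ ℕ. Assume (i) Σ_{j≥1} 1/N_j² < 1/4, and (ii) for every j ≥ 1, every L ≤ A_j = √N_j, and all u, v ∈ Σ^L, B_{N_j}(u,v) ≤ 1/N_j². Then for every L ≥ 0 there exist prefixes u, v ∈ Σ^L such that Φ_L(u,v) < 1. -/

import Mathlib

open MeasureTheory Filter Finset
open scoped ENNReal ProbabilityTheory

/-- A deterministic shuffler over the alphabet `Fin k`, with state set `Fin S.n`.
`τ q = true` means: read from tape 1 (the `x` tape); `τ q = false` means tape 2. -/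
structure Shuffler (k : ℕ) where
  n : ℕ
  q0 : Fin n
  δ : Fin n → Fin k → Fin n
  τ : Fin n → Bool

namespace Shuffler

variable {k : ℕ}

/-- Configuration after `t` output steps: current state, and the numbers of symbols
consumed from tape 1 and from tape 2. -/
def conf (S : Shuffler k) (x y : ℕ → Fin k) : ℕ → Fin S.n × ℕ × ℕ
  | 0 => (S.q0, 0, 0)
  | t + 1 =>
    match S.conf x y t with
    | (q, a, b) =>
      if S.τ q then (S.δ q (x a), a + 1, b) else (S.δ q (y b), a, b + 1)

/-- The shuffled output word `S(x,y) : ℕ → Fin k`. -/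
def out (S : Shuffler k) (x y : ℕ → Fin k) (t : ℕ) : Fin k :=
  match S.conf x y t with
  | (q, a, b) => if S.τ q then x a else y b

end Shuffler

/-- The length-`n` prefix of an infinite word. -/
def wpre {k : ℕ} (x : ℕ → Fin k) (n : ℕ) : List (Fin k) :=
  List.ofFn (fun i : Fin n => x i)

/-- Overlapping occurrence count of the block `w` inside the finite word `u`. -/
def occ {k : ℕ} (u w : List (Fin k)) : ℕ :=
  ((Finset.range (u.length + 1 - w.length)).filter
    (fun t => (u.drop t).take w.length = w)).card

/-- Aligned (non-overlapping) occurrence count of `w` among the consecutive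
`|w|`-blocks of `u`. -/
def alocc {k : ℕ} (u w : List (Fin k)) : ℕ :=
  ((Finset.range (u.length / w.length)).filter
    (fun j => (u.drop (j * w.length)).take w.length = w)).card

/-- Borel normality of an infinite word over `Fin k`. -/
def IsNormal {k : ℕ} (z : ℕ → Fin k) : Prop :=
  ∀ w : List (Fin k), w ≠ [] →
    Tendsto (fun n => (occ (wpre z n) w : ℝ) / (n : ℝ)) atTop
      (nhds ((1 : ℝ) / (k : ℝ) ^ w.length))

/-- The cylinder determined by a finite word. -/
def cyl {k : ℕ} (u : List (Fin k)) : Set (ℕ → Fin k) :=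
  {x | wpre x u.length = u}

/-- `ν` is the i.i.d. uniform product measure on `ℕ → Fin k`:
it gives every cylinder of a length-`n` word measure `k⁻ⁿ`. -/
def IsUniformProductMeasure {k : ℕ} (ν : Measure (ℕ → Fin k)) : Prop :=
  IsProbabilityMeasure ν ∧ ∀ u : List (Fin k), ν (cyl u) = ((k : ℝ≥0∞))⁻¹ ^ u.length

noncomputable def elln (k n : ℕ) : ℕ := ⌊Real.logb k n / 3⌋₊

noncomputable def epsn (k n : ℕ) : ℝ :=
  2 * Real.sqrt (Real.log n * Real.logb k n / n)

def mnr (n r : ℕ) : ℕ := n / r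

/-- The good event `E_S(n, r, w)` (with `r = w.length`). -/
def ESet {k : ℕ} (S : Shuffler k) (n : ℕ) (w : List (Fin k)) :
    Set ((ℕ → Fin k) × (ℕ → Fin k)) :=
  {p | |(alocc (wpre (S.out p.1 p.2) n) w : ℝ) - (mnr n w.length : ℝ) / (k : ℝ) ^ w.length|
        < epsn k n * (mnr n w.length : ℝ)}

/-- Total conditional bad mass `B_n(u,v)` for the first `n` shufflers of the sequence `S`. -/
noncomputable def Bn {k : ℕ} (μ : Measure ((ℕ → Fin k) × (ℕ → Fin k)))
    (S : ℕ → Shuffler k) (n : ℕ) (u v : List (Fin k)) : ℝ≥0∞ :=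
  ∑ i ∈ Finset.Icc 1 n, ∑ r ∈ Finset.Icc 1 (elln k n), ∑ w : Fin r → Fin k,
    ProbabilityTheory.cond μ (cyl u ×ˢ cyl v) (ESet (S i) n (List.ofFn w))ᶜ

/-- The rolling potential `Φ_L(u,v)` with checkpoints `N_j = (j+m₀)^4`
and activation lengths `A_j = (j+m₀)^2`. -/
noncomputable def Phi {k : ℕ} (μ : Measure ((ℕ → Fin k) × (ℕ → Fin k)))
    (S : ℕ → Shuffler k) (m₀ : ℕ) (L : ℕ) (u v : List (Fin k)) : ℝ≥0∞ :=
  ∑ j ∈ (Finset.Icc 1 L).filter (fun j => (j + m₀) ^ 2 ≤ L ∧ L ≤ (j + m₀) ^ 4),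
    Bn μ S ((j + m₀) ^ 4) u v

/-- `Test(u; m, ε)`: all `m`-blocks of `u` have frequency within `ε` of `k^{-m}`. -/
def TestP {k : ℕ} (u : List (Fin k)) (m : ℕ) (ε : ℝ) : Prop :=
  ∀ w : List (Fin k), w.length = m →
    |(occ u w : ℝ) / (u.length : ℝ) - (1 : ℝ) / (k : ℝ) ^ m| ≤ ε

/-- The test event `E_S(n; m, ε)`. -/
def ETest {k : ℕ} (S : Shuffler k) (n m : ℕ) (ε : ℝ) :
    Set ((ℕ → Fin k) × (ℕ → Fin k)) :=
  {p | TestP (wpre (S.out p.1 p.2) n) m ε}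

/-- The quadratic window slice `H_t(N)(x)`. -/
def Hslice {k : ℕ} (S : ℕ → Shuffler k) (t N : ℕ) (x : ℕ → Fin k) :
    Set (ℕ → Fin k) :=
  ⋂ i ∈ Finset.Icc 1 t, ⋂ ℓ ∈ Finset.Icc 1 t, ⋂ n ∈ Finset.Icc N (N ^ 2),
    {y | (x, y) ∈ ETest (S i) n ℓ ((1 : ℝ) / 2 ^ t)}

/-- A finite encoding of a shuffler, suitable for computability statements. -/
def Shuffler.encode {k : ℕ} (S : Shuffler k) : ℕ × ℕ × List ℕ × List Bool :=
  (S.n, (S.q0 : ℕ),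
    (List.finRange S.n).flatMap (fun q => (List.finRange k).map (fun a => ((S.δ q a : ℕ)))),
    (List.finRange S.n).map S.τ)

theorem measurableSet_cyl {k : ℕ} (u : List (Fin k)) : MeasurableSet (cyl u) := by
  have h : Measurable (fun (x : ℕ → Fin k) (i : Fin u.length) => x i) := by fun_prop
  exact h (Set.toFinite {f : Fin u.length → Fin k | List.ofFn f = u}).measurableSet

theorem wpre_succ {k : ℕ} (x : ℕ → Fin k) (n : ℕ) : wpre x (n + 1) = wpre x n ++ [x n] := by
  rw [wpre, List.ofFn_succ_last]
  simp [wpre]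

theorem mem_cyl_append_singleton {k : ℕ} (u : List (Fin k)) (a : Fin k) (x : ℕ → Fin k) :
    x ∈ cyl (u ++ [a]) ↔ x ∈ cyl u ∧ x u.length = a := by
  simp only [cyl, Set.mem_ofPred_eq, List.length_append, List.length_singleton, wpre_succ]
  constructor
  · intro h
    obtain ⟨h₁, h₂⟩ := List.append_inj h (by simp [wpre])
    exact ⟨h₁, by simpa using h₂⟩
  · rintro ⟨h₁, h₂⟩
    rw [h₁, h₂]

theorem iUnion_cyl_prod_append {k : ℕ} (u v : List (Fin k)) :
    ⋃ p : Fin k × Fin k, cyl (u ++ [p.1]) ×ˢ cyl (v ++ [p.2]) = cyl u ×ˢ cyl v := by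
  ext x
  simp [mem_cyl_append_singleton]

theorem pairwise_disjoint_cyl_prod_append {k : ℕ} (u v : List (Fin k)) :
    Pairwise (Function.onFun Disjoint
      fun p : Fin k × Fin k => cyl (u ++ [p.1]) ×ˢ cyl (v ++ [p.2])) := by
  intro p q hpq
  refine Set.disjoint_left.2 fun x hp hq => hpq ?_
  simp only [Set.mem_prod, mem_cyl_append_singleton] at hp hq
  exact Prod.ext (hp.1.2.symm.trans hq.1.2) (hp.2.2.symm.trans hq.2.2)

/-- A rectangle of cylinders is split into `k ^ 2` pieces of equal mass by one more symbol on
each tape. -/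
theorem sum_cond_append {k : ℕ} {ν : Measure (ℕ → Fin k)}
    (hν : IsUniformProductMeasure ν) (T : Set ((ℕ → Fin k) × (ℕ → Fin k)))
    (u v : List (Fin k)) :
    ∑ p : Fin k × Fin k,
        ProbabilityTheory.cond (ν.prod ν) (cyl (u ++ [p.1]) ×ˢ cyl (v ++ [p.2])) T =
      (k : ℝ≥0∞) ^ 2 * ProbabilityTheory.cond (ν.prod ν) (cyl u ×ˢ cyl v) T := by
  have := hν.1
  have hmeas (u v : List (Fin k)) : MeasurableSet (cyl u ×ˢ cyl v) :=
    (measurableSet_cyl u).prod (measurableSet_cyl v)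
  have hmass (u v : List (Fin k)) :
      ((ν.prod ν) (cyl u ×ˢ cyl v))⁻¹ = (k : ℝ≥0∞) ^ (u.length + v.length) := by
    rw [Measure.prod_prod, hν.2, hν.2, ← pow_add, ← ENNReal.inv_pow, inv_inv]
  have hsplit : ∑ p : Fin k × Fin k, (ν.prod ν) (cyl (u ++ [p.1]) ×ˢ cyl (v ++ [p.2]) ∩ T) =
      (ν.prod ν) (cyl u ×ˢ cyl v ∩ T) := by
    simp_rw [← Measure.restrict_apply (hmeas _ _)]
    rw [← iUnion_cyl_prod_append u v,
      measure_iUnion (pairwise_disjoint_cyl_prod_append u v) fun p => hmeas _ _, tsum_fintype]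
  simp_rw [ProbabilityTheory.cond_apply (hmeas _ _), hmass]
  rw [← hsplit, mul_sum, mul_sum]
  refine sum_congr rfl fun p _ => ?_
  simp only [List.length_append, List.length_singleton]
  ring

theorem sum_Bn_append {k : ℕ} {ν : Measure (ℕ → Fin k)}
    (hν : IsUniformProductMeasure ν) (S : ℕ → Shuffler k) (n : ℕ) (u v : List (Fin k)) :
    ∑ p : Fin k × Fin k, Bn (ν.prod ν) S n (u ++ [p.1]) (v ++ [p.2]) =
      (k : ℝ≥0∞) ^ 2 * Bn (ν.prod ν) S n u v := by
  simp only [Bn, mul_sum]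
  rw [sum_comm]
  refine sum_congr rfl fun i _ => ?_
  rw [sum_comm]
  refine sum_congr rfl fun r _ => ?_
  rw [sum_comm]
  exact sum_congr rfl fun w _ => sum_cond_append hν _ u v

/-- Some one-symbol extension does not increase a given finite sum of bad masses. -/
theorem exists_sum_Bn_append_le {k : ℕ} (hk : k ≠ 0) {ν : Measure (ℕ → Fin k)}
    (hν : IsUniformProductMeasure ν) (S : ℕ → Shuffler k) (J : Finset ℕ) (N : ℕ → ℕ)
    (u v : List (Fin k)) :
    ∃ a b : Fin k, ∑ j ∈ J, Bn (ν.prod ν) S (N j) (u ++ [a]) (v ++ [b]) ≤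
      ∑ j ∈ J, Bn (ν.prod ν) S (N j) u v := by
  by_contra! h
  have : NeZero k := ⟨hk⟩
  have hlt := ENNReal.sum_lt_sum_of_nonempty (s := (univ : Finset (Fin k × Fin k)))
    univ_nonempty fun p _ => h p.1 p.2
  have hsum : ∑ p : Fin k × Fin k, ∑ j ∈ J, Bn (ν.prod ν) S (N j) (u ++ [p.1]) (v ++ [p.2]) =
      (k : ℝ≥0∞) ^ 2 * ∑ j ∈ J, Bn (ν.prod ν) S (N j) u v := by
    rw [sum_comm, mul_sum]
    exact sum_congr rfl fun j _ => sum_Bn_append hν S (N j) u v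
  simp [hsum, pow_two] at hlt

theorem exists_Phi_le {k : ℕ} (hk : k ≠ 0) (S : ℕ → Shuffler k) (m₀ : ℕ)
    {ν : Measure (ℕ → Fin k)} (hν : IsUniformProductMeasure ν) (c : ℕ → ℝ≥0∞)
    (hact : ∀ j : ℕ, 1 ≤ j → ∀ u v : List (Fin k),
      u.length = (j + m₀) ^ 2 → v.length = (j + m₀) ^ 2 →
        Bn (ν.prod ν) S ((j + m₀) ^ 4) u v ≤ c j) (L : ℕ) :
    ∃ u v : List (Fin k), u.length = L ∧ v.length = L ∧
      Phi (ν.prod ν) S m₀ L u v ≤ ∑ j ∈ (Icc 1 L).filter (fun j => (j + m₀) ^ 2 ≤ L), c j := by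
  induction L with
  | zero => exact ⟨[], [], rfl, rfl, by simp [Phi]⟩
  | succ L ih =>
    obtain ⟨u, v, hu, hv, h⟩ := ih
    obtain ⟨a, b, hab⟩ := exists_sum_Bn_append_le hk hν S
      ((Icc 1 L).filter fun j => (j + m₀) ^ 2 ≤ L ∧ L ≤ (j + m₀) ^ 4)
      (fun j => (j + m₀) ^ 4) u v
    refine ⟨u ++ [a], v ++ [b], by simp [hu], by simp [hv], ?_⟩
    have hle (j : ℕ) : j ≤ (j + m₀) ^ 2 := by nlinarith [Nat.le_self_pow two_ne_zero (j + m₀)]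
    have hdisj : Disjoint ((Icc 1 L).filter fun j => (j + m₀) ^ 2 ≤ L)
        ((Icc 1 (L + 1)).filter fun j => (j + m₀) ^ 2 = L + 1) := by
      refine disjoint_left.2 fun j h1 h2 => ?_
      simp only [mem_filter] at h1 h2
      omega
    have hsplit : (Icc 1 (L + 1)).filter (fun j => (j + m₀) ^ 2 ≤ L + 1) =
        ((Icc 1 L).filter fun j => (j + m₀) ^ 2 ≤ L) ∪
          (Icc 1 (L + 1)).filter fun j => (j + m₀) ^ 2 = L + 1 := by
      ext j
      have := hle j
      simp only [mem_filter, mem_union, mem_Icc]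
      omega
    have hsub : ((Icc 1 (L + 1)).filter fun j => (j + m₀) ^ 2 ≤ L + 1 ∧ L + 1 ≤ (j + m₀) ^ 4) ⊆
        ((Icc 1 L).filter fun j => (j + m₀) ^ 2 ≤ L ∧ L ≤ (j + m₀) ^ 4) ∪
          (Icc 1 (L + 1)).filter fun j => (j + m₀) ^ 2 = L + 1 := by
      intro j
      have := hle j
      simp only [mem_filter, mem_union, mem_Icc]
      omega
    rw [hsplit, sum_union hdisj]
    refine (sum_le_sum_of_subset hsub).trans <|
      (le_self_add.trans sum_union_inter.le).trans <| add_le_add (hab.trans h) (sum_le_sum fun j hj => ?_)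
    simp only [mem_filter, mem_Icc] at hj
    exact hact j hj.1.1 _ _ (by simp [hu, hj.2]) (by simp [hv, hj.2])

/-- if the checkpoint tails are summable below `1/4` and newly
activated bad masses are small, then at every length there are prefixes keeping
the rolling potential below `1`. -/
theorem stmt_8 (k : ℕ) (hk : 2 ≤ k) (S : ℕ → Shuffler k) (m₀ : ℕ)
    (ν : Measure (ℕ → Fin k)) (hν : IsUniformProductMeasure ν)
    (hsum : ∑' j : ℕ, ((((j + 1 + m₀) ^ 4 : ℕ) : ℝ≥0∞) ^ 2)⁻¹ < 1 / 4)
    (hact : ∀ j : ℕ, 1 ≤ j → ∀ L : ℕ, L ≤ (j + m₀) ^ 2 →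
      ∀ u v : List (Fin k), u.length = L → v.length = L →
        Bn (ν.prod ν) S ((j + m₀) ^ 4) u v ≤ ((((j + m₀) ^ 4 : ℕ) : ℝ≥0∞) ^ 2)⁻¹) :
    ∀ L : ℕ, ∃ u v : List (Fin k), u.length = L ∧ v.length = L ∧
      Phi (ν.prod ν) S m₀ L u v < 1 := by
  intro L
  obtain ⟨u, v, hu, hv, h⟩ := exists_Phi_le (by omega) S m₀ hν _
    (fun j hj u v hu hv => hact j hj _ le_rfl u v hu hv) L
  refine ⟨u, v, hu, hv, h.trans_lt ?_⟩
  calc _ ≤ ∑ j ∈ Icc 1 L, ((((j + m₀) ^ 4 : ℕ) : ℝ≥0∞) ^ 2)⁻¹ :=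
        sum_le_sum_of_subset (filter_subset _ _)
    _ = ∑ j ∈ range L, ((((j + 1 + m₀) ^ 4 : ℕ) : ℝ≥0∞) ^ 2)⁻¹ := by
        rw [range_eq_Ico, sum_Ico_add' (fun j => ((((j + m₀) ^ 4 : ℕ) : ℝ≥0∞) ^ 2)⁻¹) 0 L 1]
        rfl
    _ ≤ ∑' j : ℕ, ((((j + 1 + m₀) ^ 4 : ℕ) : ℝ≥0∞) ^ 2)⁻¹ := ENNReal.sum_le_tsum _
    _ < 1 / 4 := hsum
    _ ≤ 1 := by simp
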